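/- Equivalence of GT⁻ and GT'⁻: a sequent Γ ⇒ Δ is derivable in GT⁻ if and only if it is derivable in GT'⁻, where GT' is obtained from GT by replacing the shared-context rules R∧ and L∨ with the independent-context rules R∧' (from Γ₁⇒φ,Δ₁ and Γ₂⇒ψ,Δ₂ infer Γ₁,Γ₂⇒φ∧ψ,Δ₁,Δ₂) and L∨' (from Γ₁,φ⇒Δ₁ and Γ₂,ψ⇒Δ₂ infer Γ₁,Γ₂,φ∨ψ⇒Δ₁,Δ₂), and adding the explicit structural rules LC (from Γ,φ,φ⇒Δ infer Γ,φ⇒Δ, for any PL(∨∨) formula φ) and RC (from Γ⇒α,α,Δ infer Γ⇒α,Δ, for classical α). -/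

import Mathlib

/-! Basic propositional team logic PL(∨∨): syntax, team semantics,
resolutions, and the sequent calculi GT, G3cp, GT'. -/

/-- Valuations over a countably infinite set of propositional variables (ℕ). -/
abbrev Val : Type := ℕ → Bool

/-- A team is a set of valuations. -/
abbrev Team : Type := Set Val

/-- Formulas; PL(∨∨) formulas are the well-formed (`WF`) ones, in which
negation is applied only to classical formulas. `disj` is the split
disjunction ∨ and `idisj` the inquisitive disjunction ∨∨. -/
inductive Form : Type where
  | var : ℕ → Form
  | bot : Form
  | neg : Form → Form
  | conj : Form → Form → Form
  | disj : Form → Form → Form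
  | idisj : Form → Form → Form

namespace Form

/-- Classical (CPL) formulas: no inquisitive disjunction. -/
def IsClassical : Form → Prop
  | var _ => True
  | bot => True
  | neg α => IsClassical α
  | conj α β => IsClassical α ∧ IsClassical β
  | disj α β => IsClassical α ∧ IsClassical β
  | idisj _ _ => False

/-- Well-formed formulas = formulas of PL(∨∨): negation applies only to
classical formulas. -/
def WF : Form → Prop
  | var _ => True
  | bot => True
  | neg α => IsClassical α
  | conj φ ψ => WF φ ∧ WF ψ
  | disj φ ψ => WF φ ∧ WF ψ
  | idisj φ ψ => WF φ ∧ WF ψ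

/-- Team satisfaction. -/
def Sat : Form → Team → Prop
  | var p, t => ∀ v ∈ t, v p = true
  | bot, t => t = ∅
  | neg α, t => ∀ v ∈ t, ¬ Sat α {v}
  | conj φ ψ, t => Sat φ t ∧ Sat ψ t
  | disj φ ψ, t => ∃ s u : Team, t = s ∪ u ∧ Sat φ s ∧ Sat ψ u
  | idisj φ ψ, t => Sat φ t ∨ Sat ψ t

/-- Single-valuation (classical) satisfaction, for classical formulas. -/
def CSat : Form → Val → Prop
  | var p, v => v p = true
  | bot, _ => False
  | neg α, v => ¬ CSat α v
  | conj α β, v => CSat α v ∧ CSat β v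
  | disj α β, v => CSat α v ∨ CSat β v
  | idisj _ _, _ => False

/-- The set of resolutions of a formula. -/
def res : Form → Set Form
  | var p => {var p}
  | bot => {bot}
  | neg α => Form.neg '' res α
  | conj φ ψ => Set.image2 Form.conj (res φ) (res ψ)
  | disj φ ψ => Set.image2 Form.disj (res φ) (res ψ)
  | idisj φ ψ => res φ ∪ res ψ

/-- Propositional variables occurring in a formula. -/
def vars : Form → Set ℕ
  | var p => {p}
  | bot => ∅
  | neg α => vars α
  | conj φ ψ => vars φ ∪ vars ψ
  | disj φ ψ => vars φ ∪ vars ψ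
  | idisj φ ψ => vars φ ∪ vars ψ

/-- Signed occurrences: `svars φ true` = positively occurring variables,
`svars φ false` = negatively occurring variables. -/
def svars : Form → Bool → Set ℕ
  | var p, b => if b then {p} else ∅
  | bot, _ => ∅
  | neg α, b => svars α (!b)
  | conj φ ψ, b => svars φ b ∪ svars ψ b
  | disj φ ψ, b => svars φ b ∪ svars ψ b
  | idisj φ ψ, b => svars φ b ∪ svars ψ b

/-- Positively occurring variables P⁺(φ). -/
def pvars (φ : Form) : Set ℕ := φ.svars true

/-- Negatively occurring variables P⁻(φ). -/
def nvars (φ : Form) : Set ℕ := φ.svars false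

end Form

/-- `t ⊨ Γ`: every formula of the multiset Γ is satisfied by `t`. -/
def SatAll (t : Team) (Γ : Multiset Form) : Prop := ∀ φ ∈ Γ, Form.Sat φ t

/-- Team entailment Γ ⊨ φ. -/
def Entails (Γ : Multiset Form) (φ : Form) : Prop :=
  ∀ t : Team, SatAll t Γ → Form.Sat φ t

/-- Resolutions R(Γ) of a multiset of formulas: images of Γ under resolution
functions. -/
def mres (Γ : Multiset Form) : Set (Multiset Form) :=
  {Ξ | ∃ f : Form → Form, (∀ φ ∈ Γ, f φ ∈ Form.res φ) ∧ Ξ = Γ.map f}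

/-- Variables occurring in a multiset of formulas. -/
def mvars (Γ : Multiset Form) : Set ℕ := {p | ∃ φ ∈ Γ, p ∈ Form.vars φ}

/-- P⁺(Γ). -/
def mpvars (Γ : Multiset Form) : Set ℕ := {p | ∃ φ ∈ Γ, p ∈ Form.pvars φ}

/-- P⁻(Γ). -/
def mnvars (Γ : Multiset Form) : Set ℕ := {p | ∃ φ ∈ Γ, p ∈ Form.nvars φ}

/-- The split disjunction ⋁Δ of a multiset (⊥ for the empty multiset).
(Satisfaction is invariant under the order of the chosen list.) -/
noncomputable def bigVee (Δ : Multiset Form) : Form :=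
  Δ.toList.foldr Form.disj Form.bot

/-- One-hole formula contexts in which the hole does not occur in the scope
of a negation; these represent the subformula occurrences to which the
deep-inference rules may be applied. -/
inductive Ctx : Type where
  | hole : Ctx
  | conjL : Ctx → Form → Ctx
  | conjR : Form → Ctx → Ctx
  | disjL : Ctx → Form → Ctx
  | disjR : Form → Ctx → Ctx
  | idisjL : Ctx → Form → Ctx
  | idisjR : Form → Ctx → Ctx

/-- Plugging a formula into a context: χ{η}. -/
def Ctx.fill : Ctx → Form → Form
  | .hole, η => η
  | .conjL c ψ, η => Form.conj (c.fill η) ψ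
  | .conjR ψ c, η => Form.conj ψ (c.fill η)
  | .disjL c ψ, η => Form.disj (c.fill η) ψ
  | .disjR ψ c, η => Form.disj ψ (c.fill η)
  | .idisjL c ψ, η => Form.idisj (c.fill η) ψ
  | .idisjR ψ c, η => Form.idisj ψ (c.fill η)

/-- The sequent calculus GT. `GT c n Γ Δ` means: the sequent Γ ⇒ Δ has a
derivation of height at most `n`, using Cut only if `c = true`.
So `∃ n, GT true n Γ Δ` is derivability in GT, `∃ n, GT false n Γ Δ` is
derivability in the cut-free fragment GT⁻, and `GT false n Γ Δ` is
`⊢ⁿ Γ ⇒ Δ` (cut-free derivability with height at most n). -/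
inductive GT : Bool → ℕ → Multiset Form → Multiset Form → Prop
  | ax (c : Bool) (n : ℕ) (Γ Δ : Multiset Form) (p : ℕ) :
      GT c (n + 1) (Form.var p ::ₘ Γ) (Form.var p ::ₘ Δ)
  | lbot (c : Bool) (n : ℕ) (Γ Δ : Multiset Form) :
      GT c (n + 1) (Form.bot ::ₘ Γ) Δ
  | lneg (c : Bool) (n : ℕ) (Γ Δ : Multiset Form) (α : Form) :
      Form.IsClassical α → GT c n Γ (α ::ₘ Δ) →
      GT c (n + 1) (Form.neg α ::ₘ Γ) Δ
  | rneg (c : Bool) (n : ℕ) (Γ Δ : Multiset Form) (α : Form) :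
      Form.IsClassical α → GT c n (α ::ₘ Γ) Δ →
      GT c (n + 1) Γ (Form.neg α ::ₘ Δ)
  | lconj (c : Bool) (n : ℕ) (Γ Δ : Multiset Form) (φ ψ : Form) :
      GT c n (φ ::ₘ ψ ::ₘ Γ) Δ →
      GT c (n + 1) (Form.conj φ ψ ::ₘ Γ) Δ
  | rconj (c : Bool) (n : ℕ) (Γ Λ Δ : Multiset Form) (φ ψ : Form) :
      (∀ γ ∈ Λ, Form.IsClassical γ) →
      GT c n Γ (φ ::ₘ Λ) → GT c n Γ (ψ ::ₘ Λ) →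
      GT c (n + 1) Γ (Form.conj φ ψ ::ₘ (Λ + Δ))
  | ldisj (c : Bool) (n : ℕ) (Γ Λ Δ : Multiset Form) (φ ψ : Form) :
      (∀ γ ∈ Λ, Form.IsClassical γ) →
      GT c n (φ ::ₘ Γ) Λ → GT c n (ψ ::ₘ Γ) Λ →
      GT c (n + 1) (Form.disj φ ψ ::ₘ Γ) (Λ + Δ)
  | rdisj (c : Bool) (n : ℕ) (Γ Δ : Multiset Form) (φ ψ : Form) :
      GT c n Γ (φ ::ₘ ψ ::ₘ Δ) →
      GT c (n + 1) Γ (Form.disj φ ψ ::ₘ Δ)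
  | lidisj (c : Bool) (n : ℕ) (Γ Δ : Multiset Form) (χ : Ctx) (φL φR : Form) :
      GT c n (χ.fill φL ::ₘ Γ) Δ → GT c n (χ.fill φR ::ₘ Γ) Δ →
      GT c (n + 1) (χ.fill (Form.idisj φL φR) ::ₘ Γ) Δ
  | ridisjL (c : Bool) (n : ℕ) (Γ Δ : Multiset Form) (χ : Ctx) (φL φR : Form) :
      GT c n Γ (χ.fill φL ::ₘ Δ) →
      GT c (n + 1) Γ (χ.fill (Form.idisj φL φR) ::ₘ Δ)
  | ridisjR (c : Bool) (n : ℕ) (Γ Δ : Multiset Form) (χ : Ctx) (φL φR : Form) :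
      GT c n Γ (χ.fill φR ::ₘ Δ) →
      GT c (n + 1) Γ (χ.fill (Form.idisj φL φR) ::ₘ Δ)
  | cut (n : ℕ) (Γ Δ Θ S : Multiset Form) (φ : Form) :
      GT true n Γ (φ ::ₘ Δ) → GT true n (φ ::ₘ Θ) S →
      GT true (n + 1) (Γ + Θ) (Δ + S)

/-- The classical sequent calculus G3cp (on classical formulas).
`G3 false` is its cut-free fragment G3cp⁻. -/
inductive G3 : Bool → Multiset Form → Multiset Form → Prop
  | ax (c : Bool) (Γ Δ : Multiset Form) (p : ℕ) :
      (∀ α ∈ Γ, Form.IsClassical α) → (∀ α ∈ Δ, Form.IsClassical α) →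
      G3 c (Form.var p ::ₘ Γ) (Form.var p ::ₘ Δ)
  | lbot (c : Bool) (Γ Δ : Multiset Form) :
      (∀ α ∈ Γ, Form.IsClassical α) → (∀ α ∈ Δ, Form.IsClassical α) →
      G3 c (Form.bot ::ₘ Γ) Δ
  | lneg (c : Bool) (Γ Δ : Multiset Form) (α : Form) :
      Form.IsClassical α → G3 c Γ (α ::ₘ Δ) → G3 c (Form.neg α ::ₘ Γ) Δ
  | rneg (c : Bool) (Γ Δ : Multiset Form) (α : Form) :
      Form.IsClassical α → G3 c (α ::ₘ Γ) Δ → G3 c Γ (Form.neg α ::ₘ Δ)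
  | lconj (c : Bool) (Γ Δ : Multiset Form) (α β : Form) :
      G3 c (α ::ₘ β ::ₘ Γ) Δ → G3 c (Form.conj α β ::ₘ Γ) Δ
  | rconj (c : Bool) (Γ Λ Δ : Multiset Form) (α β : Form) :
      (∀ γ ∈ Λ, Form.IsClassical γ) → (∀ γ ∈ Δ, Form.IsClassical γ) →
      G3 c Γ (α ::ₘ Λ) → G3 c Γ (β ::ₘ Λ) →
      G3 c Γ (Form.conj α β ::ₘ (Λ + Δ))
  | ldisj (c : Bool) (Γ Λ Δ : Multiset Form) (α β : Form) :
      (∀ γ ∈ Λ, Form.IsClassical γ) → (∀ γ ∈ Δ, Form.IsClassical γ) →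
      G3 c (α ::ₘ Γ) Λ → G3 c (β ::ₘ Γ) Λ →
      G3 c (Form.disj α β ::ₘ Γ) (Λ + Δ)
  | rdisj (c : Bool) (Γ Δ : Multiset Form) (α β : Form) :
      G3 c Γ (α ::ₘ β ::ₘ Δ) → G3 c Γ (Form.disj α β ::ₘ Δ)
  | cut (Γ Δ Θ S : Multiset Form) (α : Form) :
      Form.IsClassical α →
      G3 true Γ (α ::ₘ Δ) → G3 true (α ::ₘ Θ) S →
      G3 true (Γ + Θ) (Δ + S)

/-- The cut-free variant calculus GT'⁻: GT⁻ with independent-context rules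
R∧', L∨' in place of R∧, L∨, plus explicit contraction rules LC and RC
(RC restricted to classical formulas). -/
inductive GTp : Multiset Form → Multiset Form → Prop
  | ax (Γ Δ : Multiset Form) (p : ℕ) :
      GTp (Form.var p ::ₘ Γ) (Form.var p ::ₘ Δ)
  | lbot (Γ Δ : Multiset Form) : GTp (Form.bot ::ₘ Γ) Δ
  | lneg (Γ Δ : Multiset Form) (α : Form) :
      Form.IsClassical α → GTp Γ (α ::ₘ Δ) → GTp (Form.neg α ::ₘ Γ) Δ
  | rneg (Γ Δ : Multiset Form) (α : Form) :
      Form.IsClassical α → GTp (α ::ₘ Γ) Δ → GTp Γ (Form.neg α ::ₘ Δ)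
  | lconj (Γ Δ : Multiset Form) (φ ψ : Form) :
      GTp (φ ::ₘ ψ ::ₘ Γ) Δ → GTp (Form.conj φ ψ ::ₘ Γ) Δ
  | rconj (Γ₁ Γ₂ Δ₁ Δ₂ : Multiset Form) (φ ψ : Form) :
      GTp Γ₁ (φ ::ₘ Δ₁) → GTp Γ₂ (ψ ::ₘ Δ₂) →
      GTp (Γ₁ + Γ₂) (Form.conj φ ψ ::ₘ (Δ₁ + Δ₂))
  | ldisj (Γ₁ Γ₂ Δ₁ Δ₂ : Multiset Form) (φ ψ : Form) :
      GTp (φ ::ₘ Γ₁) Δ₁ → GTp (ψ ::ₘ Γ₂) Δ₂ →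
      GTp (Form.disj φ ψ ::ₘ (Γ₁ + Γ₂)) (Δ₁ + Δ₂)
  | rdisj (Γ Δ : Multiset Form) (φ ψ : Form) :
      GTp Γ (φ ::ₘ ψ ::ₘ Δ) → GTp Γ (Form.disj φ ψ ::ₘ Δ)
  | lidisj (Γ Δ : Multiset Form) (χ : Ctx) (φL φR : Form) :
      GTp (χ.fill φL ::ₘ Γ) Δ → GTp (χ.fill φR ::ₘ Γ) Δ →
      GTp (χ.fill (Form.idisj φL φR) ::ₘ Γ) Δ
  | ridisjL (Γ Δ : Multiset Form) (χ : Ctx) (φL φR : Form) :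
      GTp Γ (χ.fill φL ::ₘ Δ) → GTp Γ (χ.fill (Form.idisj φL φR) ::ₘ Δ)
  | ridisjR (Γ Δ : Multiset Form) (χ : Ctx) (φL φR : Form) :
      GTp Γ (χ.fill φR ::ₘ Δ) → GTp Γ (χ.fill (Form.idisj φL φR) ::ₘ Δ)
  | lc (Γ Δ : Multiset Form) (φ : Form) :
      GTp (φ ::ₘ φ ::ₘ Γ) Δ → GTp (φ ::ₘ Γ) Δ
  | rc (Γ Δ : Multiset Form) (α : Form) :
      Form.IsClassical α → GTp Γ (α ::ₘ α ::ₘ Δ) → GTp Γ (α ::ₘ Δ)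

/-! Team semantics of formulas and sequents -/

namespace Form

theorem Sat.mono {φ : Form} {t s : Team} (h : φ.Sat t) (hs : s ⊆ t) : φ.Sat s := by
  induction φ generalizing t s with
  | var p => exact fun v hv => h v (hs hv)
  | bot => exact Set.subset_eq_empty hs h
  | neg α _ => exact fun v hv => h v (hs hv)
  | conj φ ψ ihφ ihψ => exact ⟨ihφ h.1 hs, ihψ h.2 hs⟩
  | disj φ ψ ihφ ihψ =>
    obtain ⟨a, b, rfl, ha, hb⟩ := h
    refine ⟨s ∩ a, s ∩ b, ?_, ihφ ha Set.inter_subset_right, ihψ hb Set.inter_subset_right⟩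
    rw [← Set.inter_union_distrib_left, Set.inter_eq_left.2 hs]
  | idisj φ ψ ihφ ihψ => exact h.imp (ihφ · hs) (ihψ · hs)

theorem sat_empty (φ : Form) : φ.Sat ∅ := by
  induction φ with
  | var p => simp [Sat]
  | bot => rfl
  | neg α _ => simp [Sat]
  | conj φ ψ ihφ ihψ => exact ⟨ihφ, ihψ⟩
  | disj φ ψ ihφ ihψ => exact ⟨∅, ∅, by simp, ihφ, ihψ⟩
  | idisj φ ψ ihφ _ => exact Or.inl ihφ

/-- Classical formulas are flat. -/
theorem IsClassical.sat_iff {α : Form} (hα : α.IsClassical) (t : Team) :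
    α.Sat t ↔ ∀ v ∈ t, α.CSat v := by
  induction α generalizing t with
  | var p => rfl
  | bot => simp [Sat, CSat, Set.eq_empty_iff_forall_notMem]
  | neg α ih => simp [Sat, CSat, ih hα]
  | conj α β ihα ihβ => simp [Sat, CSat, ihα hα.1, ihβ hα.2, forall_and]
  | disj α β ihα ihβ =>
    simp only [Sat, CSat, ihα hα.1, ihβ hα.2]
    constructor
    · rintro ⟨s, u, rfl, hs, hu⟩ v (hv | hv)
      exacts [Or.inl (hs v hv), Or.inr (hu v hv)]
    · intro h
      refine ⟨{v ∈ t | α.CSat v}, {v ∈ t | β.CSat v}, ?_, fun v hv => hv.2, fun v hv => hv.2⟩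
      ext v
      simpa [← and_or_left] using h v
  | idisj α β _ _ => exact hα.elim

end Form

namespace Ctx

theorem sat_fill_idisj (χ : Ctx) (φ ψ : Form) (t : Team) :
    (χ.fill (.idisj φ ψ)).Sat t ↔ (χ.fill φ).Sat t ∨ (χ.fill ψ).Sat t := by
  induction χ generalizing t with
  | hole => rfl
  | conjL c η ih => simp [fill, Form.Sat, ih, or_and_right]
  | conjR η c ih => simp [fill, Form.Sat, ih, and_or_left]
  | disjL c η ih => simp [fill, Form.Sat, ih, or_and_right, and_or_left, exists_or]
  | disjR η c ih => simp [fill, Form.Sat, ih, and_or_left, exists_or]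
  | idisjL c η ih => simp only [fill, Form.Sat, ih]; tauto
  | idisjR η c ih => simp only [fill, Form.Sat, ih]; tauto

theorem wf_fill_idisj (χ : Ctx) (φ ψ : Form) :
    (χ.fill (.idisj φ ψ)).WF ↔ (χ.fill φ).WF ∧ (χ.fill ψ).WF := by
  induction χ with
  | hole => rfl
  | conjL c η ih => simp only [fill, Form.WF, ih]; tauto
  | conjR η c ih => simp only [fill, Form.WF, ih]; tauto
  | disjL c η ih => simp only [fill, Form.WF, ih]; tauto
  | disjR η c ih => simp only [fill, Form.WF, ih]; tauto
  | idisjL c η ih => simp only [fill, Form.WF, ih]; tauto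
  | idisjR η c ih => simp only [fill, Form.WF, ih]; tauto

theorem sizeOf_fill_lt (χ : Ctx) {φ ψ : Form} (h : sizeOf φ < sizeOf ψ) :
    sizeOf (χ.fill φ) < sizeOf (χ.fill ψ) := by
  induction χ <;> simp [fill] <;> omega

end Ctx

theorem Form.WF.exists_fill_idisj {φ : Form} (h : φ.WF) (hc : ¬ φ.IsClassical) :
    ∃ (χ : Ctx) (ψ η : Form), φ = χ.fill (.idisj ψ η) := by
  induction φ with
  | var p => exact (hc trivial).elim
  | bot => exact (hc trivial).elim
  | neg α _ => exact (hc h).elim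
  | conj φ ψ ihφ ihψ =>
    by_cases hφ : φ.IsClassical
    · obtain ⟨χ, a, b, rfl⟩ := ihψ h.2 fun hψ => hc ⟨hφ, hψ⟩
      exact ⟨.conjR φ χ, a, b, rfl⟩
    · obtain ⟨χ, a, b, rfl⟩ := ihφ h.1 hφ
      exact ⟨.conjL χ ψ, a, b, rfl⟩
  | disj φ ψ ihφ ihψ =>
    by_cases hφ : φ.IsClassical
    · obtain ⟨χ, a, b, rfl⟩ := ihψ h.2 fun hψ => hc ⟨hφ, hψ⟩
      exact ⟨.disjR φ χ, a, b, rfl⟩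
    · obtain ⟨χ, a, b, rfl⟩ := ihφ h.1 hφ
      exact ⟨.disjL χ ψ, a, b, rfl⟩
  | idisj φ ψ _ _ => exact ⟨.hole, φ, ψ, rfl⟩

theorem satAll_cons {t : Team} {φ : Form} {Γ : Multiset Form} :
    SatAll t (φ ::ₘ Γ) ↔ φ.Sat t ∧ SatAll t Γ := by
  simp [SatAll]

theorem satAll_add {t : Team} {Γ₁ Γ₂ : Multiset Form} :
    SatAll t (Γ₁ + Γ₂) ↔ SatAll t Γ₁ ∧ SatAll t Γ₂ := by
  simp [SatAll, or_imp, forall_and]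

theorem SatAll.mono {t s : Team} {Γ : Multiset Form} (h : SatAll t Γ) (hs : s ⊆ t) :
    SatAll s Γ :=
  fun φ hφ => (h φ hφ).mono hs

/-- One layer of the split disjunction of a multiset. -/
def splitWith (φ : Form) (P : Team → Prop) (t : Team) : Prop :=
  ∃ s u : Team, t = s ∪ u ∧ φ.Sat s ∧ P u

instance : LeftCommutative splitWith where
  left_comm φ ψ P := by
    have key : ∀ φ ψ t, splitWith φ (splitWith ψ P) t → splitWith ψ (splitWith φ P) t := by
      rintro φ ψ _ ⟨s, _, rfl, hs, u, w, rfl, hu, hw⟩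
      exact ⟨u, s ∪ w, Set.union_left_comm s u w, hu, s, w, rfl, hs, hw⟩
    funext t
    exact propext ⟨key φ ψ t, key ψ φ t⟩

/-- `t ⊨ ⋁Δ`, defined without choosing an order on `Δ`. -/
def SatVee (Δ : Multiset Form) : Team → Prop :=
  Δ.foldr splitWith (· = ∅)

theorem satVee_zero {t : Team} : SatVee 0 t ↔ t = ∅ := Iff.rfl

theorem satVee_cons {φ : Form} {Δ : Multiset Form} {t : Team} :
    SatVee (φ ::ₘ Δ) t ↔ ∃ s u : Team, t = s ∪ u ∧ φ.Sat s ∧ SatVee Δ u := by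
  simp only [SatVee, Multiset.foldr_cons, splitWith]

theorem satVee_empty (Δ : Multiset Form) : SatVee Δ ∅ := by
  induction Δ using Multiset.induction with
  | empty => rfl
  | cons φ Δ ih => exact satVee_cons.2 ⟨∅, ∅, by simp, φ.sat_empty, ih⟩

theorem SatVee.mono {Δ : Multiset Form} {t s : Team} (h : SatVee Δ t) (hs : s ⊆ t) :
    SatVee Δ s := by
  induction Δ using Multiset.induction generalizing t s with
  | empty => exact Set.subset_eq_empty hs h
  | cons φ Δ ih =>
    obtain ⟨a, b, rfl, ha, hb⟩ := satVee_cons.1 h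
    refine satVee_cons.2 ⟨s ∩ a, s ∩ b, ?_, ha.mono Set.inter_subset_right,
      ih hb Set.inter_subset_right⟩
    rw [← Set.inter_union_distrib_left, Set.inter_eq_left.2 hs]

theorem SatVee.add {Δ₁ Δ₂ : Multiset Form} {s u : Team} (hs : SatVee Δ₁ s) (hu : SatVee Δ₂ u) :
    SatVee (Δ₁ + Δ₂) (s ∪ u) := by
  induction Δ₁ using Multiset.induction generalizing s with
  | empty =>
    rw [satVee_zero.1 hs]
    simpa using hu
  | cons φ Δ ih =>
    obtain ⟨a, b, rfl, ha, hb⟩ := satVee_cons.1 hs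
    rw [Multiset.cons_add]
    exact satVee_cons.2 ⟨a, b ∪ u, Set.union_assoc a b u, ha, ih hb⟩

theorem satVee_fill_idisj {χ : Ctx} {φ ψ : Form} {Δ : Multiset Form} {t : Team} :
    SatVee (χ.fill (.idisj φ ψ) ::ₘ Δ) t ↔
      SatVee (χ.fill φ ::ₘ Δ) t ∨ SatVee (χ.fill ψ ::ₘ Δ) t := by
  simp only [satVee_cons, Ctx.sat_fill_idisj, or_and_right, and_or_left, exists_or]

theorem SatVee.exists_csat {Δ : Multiset Form} (hΔ : ∀ δ ∈ Δ, δ.IsClassical) {t : Team}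
    (h : SatVee Δ t) {v : Val} (hv : v ∈ t) : ∃ δ ∈ Δ, δ.CSat v := by
  induction Δ using Multiset.induction generalizing t with
  | empty => simp [satVee_zero.1 h] at hv
  | cons φ Δ ih =>
    rw [Multiset.forall_mem_cons] at hΔ
    obtain ⟨a, b, rfl, ha, hb⟩ := satVee_cons.1 h
    rcases hv with hv | hv
    · exact ⟨φ, Multiset.mem_cons_self _ _, (hΔ.1.sat_iff a).1 ha v hv⟩
    · obtain ⟨δ, hδ, h⟩ := ih hΔ.2 hb hv
      exact ⟨δ, Multiset.mem_cons_of_mem hδ, h⟩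

/-- Validity of the sequent `Γ ⇒ Δ`. -/
def SeqValid (Γ Δ : Multiset Form) : Prop :=
  ∀ t : Team, SatAll t Γ → SatVee Δ t

/-! Soundness of GT'⁻ and admissibility of the rules of GT⁻ in it -/

theorem GTp.sound {Γ Δ : Multiset Form} (h : GTp Γ Δ) : SeqValid Γ Δ := by
  induction h with
  | ax Γ Δ p =>
    intro t ht
    exact satVee_cons.2 ⟨t, ∅, by simp, (satAll_cons.1 ht).1, satVee_empty _⟩
  | lbot Γ Δ =>
    intro t ht
    rw [show t = ∅ from (satAll_cons.1 ht).1]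
    exact satVee_empty _
  | lneg Γ Δ α hα _ ih =>
    intro t ht
    obtain ⟨hn, ht⟩ := satAll_cons.1 ht
    obtain ⟨s, u, rfl, hs, hu⟩ := satVee_cons.1 (ih t ht)
    have : s = ∅ := Set.eq_empty_iff_forall_notMem.2 fun v hv =>
      hn v (Or.inl hv) (hs.mono (Set.singleton_subset_iff.2 hv))
    simpa [this] using hu
  | rneg Γ Δ α hα _ ih =>
    intro t ht
    refine satVee_cons.2 ⟨{v ∈ t | ¬ α.CSat v}, {v ∈ t | α.CSat v}, ?_, ?_,
      ih _ (satAll_cons.2 ⟨?_, ht.mono (Set.sep_subset _ _)⟩)⟩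
    · ext v
      by_cases h : α.CSat v <;> simp [h]
    · exact (Form.IsClassical.sat_iff (α := .neg α) hα _).2 fun v hv => hv.2
    · exact (hα.sat_iff _).2 fun v hv => hv.2
  | lconj Γ Δ φ ψ _ ih =>
    intro t ht
    obtain ⟨h, ht⟩ := satAll_cons.1 ht
    exact ih t (satAll_cons.2 ⟨h.1, satAll_cons.2 ⟨h.2, ht⟩⟩)
  | rconj Γ₁ Γ₂ Δ₁ Δ₂ φ ψ _ _ ih₁ ih₂ =>
    intro t ht
    obtain ⟨h₁, h₂⟩ := satAll_add.1 ht
    obtain ⟨s, u, hsu, hs, hu⟩ := satVee_cons.1 (ih₁ t h₁)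
    obtain ⟨s', u', hsu', hs', hu'⟩ := satVee_cons.1 (ih₂ t h₂)
    refine satVee_cons.2 ⟨s ∩ s', u ∪ u', ?_, ⟨hs.mono Set.inter_subset_left,
      hs'.mono Set.inter_subset_right⟩, hu.add hu'⟩
    ext v
    have h1 : v ∈ t ↔ v ∈ s ∨ v ∈ u := by rw [hsu]; rfl
    have h2 : v ∈ t ↔ v ∈ s' ∨ v ∈ u' := by rw [hsu']; rfl
    simp only [Set.mem_union, Set.mem_inter_iff]
    tauto
  | ldisj Γ₁ Γ₂ Δ₁ Δ₂ φ ψ _ _ ih₁ ih₂ =>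
    intro t ht
    obtain ⟨⟨s, u, rfl, hs, hu⟩, ht⟩ := satAll_cons.1 ht
    obtain ⟨h₁, h₂⟩ := satAll_add.1 ht
    exact (ih₁ s (satAll_cons.2 ⟨hs, h₁.mono Set.subset_union_left⟩)).add
      (ih₂ u (satAll_cons.2 ⟨hu, h₂.mono Set.subset_union_right⟩))
  | rdisj Γ Δ φ ψ _ ih =>
    intro t ht
    obtain ⟨s, _, rfl, hs, hu⟩ := satVee_cons.1 (ih t ht)
    obtain ⟨u, w, rfl, hu, hw⟩ := satVee_cons.1 hu
    exact satVee_cons.2 ⟨s ∪ u, w, (Set.union_assoc s u w).symm, ⟨s, u, rfl, hs, hu⟩, hw⟩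
  | lidisj Γ Δ χ φ ψ _ _ ih₁ ih₂ =>
    intro t ht
    obtain ⟨h, ht⟩ := satAll_cons.1 ht
    rcases (χ.sat_fill_idisj φ ψ t).1 h with h | h
    · exact ih₁ t (satAll_cons.2 ⟨h, ht⟩)
    · exact ih₂ t (satAll_cons.2 ⟨h, ht⟩)
  | ridisjL Γ Δ χ φ ψ _ ih => exact fun t ht => satVee_fill_idisj.2 (Or.inl (ih t ht))
  | ridisjR Γ Δ χ φ ψ _ ih => exact fun t ht => satVee_fill_idisj.2 (Or.inr (ih t ht))
  | lc Γ Δ φ _ ih =>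
    intro t ht
    exact ih t (satAll_cons.2 ⟨(satAll_cons.1 ht).1, ht⟩)
  | rc Γ Δ α hα _ ih =>
    intro t ht
    obtain ⟨s, _, rfl, hs, hu⟩ := satVee_cons.1 (ih t ht)
    obtain ⟨u, w, rfl, hu, hw⟩ := satVee_cons.1 hu
    refine satVee_cons.2 ⟨s ∪ u, w, (Set.union_assoc s u w).symm, (hα.sat_iff _).2 ?_, hw⟩
    rintro v (hv | hv)
    exacts [(hα.sat_iff _).1 hs v hv, (hα.sat_iff _).1 hu v hv]

theorem GTp.weaken_right {Γ Δ : Multiset Form} (h : GTp Γ Δ) (Θ : Multiset Form) :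
    GTp Γ (Δ + Θ) := by
  induction h with
  | ax Γ Δ p => exact Multiset.cons_add _ Δ Θ ▸ .ax Γ (Δ + Θ) p
  | lbot Γ Δ => exact .lbot Γ _
  | lneg Γ Δ α hα _ ih => exact .lneg Γ _ α hα (by rwa [Multiset.cons_add] at ih)
  | rneg Γ Δ α hα _ ih => exact Multiset.cons_add _ Δ Θ ▸ .rneg Γ _ α hα ih
  | lconj Γ Δ φ ψ _ ih => exact .lconj Γ _ φ ψ ih
  | rconj Γ₁ Γ₂ Δ₁ Δ₂ φ ψ h₁ _ _ ih₂ =>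
    rw [Multiset.cons_add, add_assoc]
    exact .rconj Γ₁ Γ₂ Δ₁ (Δ₂ + Θ) φ ψ h₁ (by rwa [Multiset.cons_add] at ih₂)
  | ldisj Γ₁ Γ₂ Δ₁ Δ₂ φ ψ h₁ _ _ ih₂ =>
    rw [add_assoc]
    exact .ldisj Γ₁ Γ₂ Δ₁ (Δ₂ + Θ) φ ψ h₁ ih₂
  | rdisj Γ Δ φ ψ _ ih =>
    rw [Multiset.cons_add]
    exact .rdisj Γ _ φ ψ (by simpa only [Multiset.cons_add] using ih)
  | lidisj Γ Δ χ φ ψ _ _ ih₁ ih₂ => exact .lidisj Γ _ χ φ ψ ih₁ ih₂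
  | ridisjL Γ Δ χ φ ψ _ ih =>
    rw [Multiset.cons_add] at ih ⊢
    exact .ridisjL Γ _ χ φ ψ ih
  | ridisjR Γ Δ χ φ ψ _ ih =>
    rw [Multiset.cons_add] at ih ⊢
    exact .ridisjR Γ _ χ φ ψ ih
  | lc Γ Δ φ _ ih => exact .lc Γ _ φ ih
  | rc Γ Δ α hα _ ih =>
    rw [Multiset.cons_add] at ih ⊢
    rw [Multiset.cons_add] at ih
    exact .rc Γ _ α hα ih

theorem GTp.contract_left {Γ Θ Δ : Multiset Form} (h : GTp (Γ + Γ + Θ) Δ) : GTp (Γ + Θ) Δ := by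
  induction Γ using Multiset.induction generalizing Θ with
  | empty => simpa using h
  | cons φ Γ ih =>
    rw [Multiset.cons_add]
    apply GTp.lc
    have h' : GTp (Γ + Γ + (φ ::ₘ φ ::ₘ Θ)) Δ := by
      simpa only [Multiset.cons_add, Multiset.add_cons] using h
    simpa only [Multiset.add_cons] using ih h'

theorem GTp.contract_right {Γ Λ Δ : Multiset Form} (hΛ : ∀ γ ∈ Λ, γ.IsClassical)
    (h : GTp Γ (Λ + Λ + Δ)) : GTp Γ (Λ + Δ) := by
  induction Λ using Multiset.induction generalizing Δ with
  | empty => simpa using h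
  | cons φ Λ ih =>
    rw [Multiset.forall_mem_cons] at hΛ
    rw [Multiset.cons_add]
    apply GTp.rc _ _ _ hΛ.1
    have h' : GTp Γ (Λ + Λ + (φ ::ₘ φ ::ₘ Δ)) := by
      simpa only [Multiset.cons_add, Multiset.add_cons] using h
    simpa only [Multiset.add_cons] using ih hΛ.2 h'

theorem GT.toGTp {n : ℕ} {Γ Δ : Multiset Form} (h : GT false n Γ Δ) : GTp Γ Δ := by
  generalize hc : false = c at h
  induction h with
  | ax c n Γ Δ p => exact .ax Γ Δ p
  | lbot c n Γ Δ => exact .lbot Γ Δ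
  | lneg c n Γ Δ α hα _ ih => exact .lneg Γ Δ α hα (ih hc)
  | rneg c n Γ Δ α hα _ ih => exact .rneg Γ Δ α hα (ih hc)
  | lconj c n Γ Δ φ ψ _ ih => exact .lconj Γ Δ φ ψ (ih hc)
  | rconj c n Γ Λ Δ φ ψ hΛ _ _ ih₁ ih₂ =>
    have h := (GTp.rconj Γ Γ Λ Λ φ ψ (ih₁ hc) (ih₂ hc)).weaken_right Δ
    have h₁ : GTp Γ (φ.conj ψ ::ₘ (Λ + Λ) + Δ) := by
      simpa using GTp.contract_left (Θ := 0) (by simpa using h)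
    have h₂ := GTp.contract_right (Δ := φ.conj ψ ::ₘ Δ) hΛ
      (by simpa only [Multiset.cons_add, Multiset.add_cons] using h₁)
    simpa only [Multiset.add_cons] using h₂
  | ldisj c n Γ Λ Δ φ ψ hΛ _ _ ih₁ ih₂ =>
    have h := (GTp.ldisj Γ Γ Λ Λ φ ψ (ih₁ hc) (ih₂ hc)).weaken_right Δ
    have h₁ := GTp.contract_left (Γ := Γ) (Θ := {φ.disj ψ})
      (by simpa [Multiset.add_cons, ← Multiset.singleton_add, add_comm] using h)
    exact GTp.contract_right hΛ
      (by simpa [← Multiset.singleton_add, add_comm] using h₁)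
  | rdisj c n Γ Δ φ ψ _ ih => exact .rdisj Γ Δ φ ψ (ih hc)
  | lidisj c n Γ Δ χ φ ψ _ _ ih₁ ih₂ => exact .lidisj Γ Δ χ φ ψ (ih₁ hc) (ih₂ hc)
  | ridisjL c n Γ Δ χ φ ψ _ ih => exact .ridisjL Γ Δ χ φ ψ (ih hc)
  | ridisjR c n Γ Δ χ φ ψ _ ih => exact .ridisjR Γ Δ χ φ ψ (ih hc)
  | cut => cases hc

/-! Completeness of GT⁻ -/

theorem GT.mono {c : Bool} {n m : ℕ} {Γ Δ : Multiset Form} (h : GT c n Γ Δ) (hnm : n ≤ m) :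
    GT c m Γ Δ := by
  induction h generalizing m <;>
    obtain ⟨m, rfl⟩ : ∃ k, m = k + 1 := ⟨m - 1, by omega⟩ <;>
    rw [Nat.add_le_add_iff_right] at hnm
  case ax => exact .ax ..
  case lbot => exact .lbot ..
  case lneg hα _ ih => exact .lneg _ _ _ _ _ hα (ih hnm)
  case rneg hα _ ih => exact .rneg _ _ _ _ _ hα (ih hnm)
  case lconj ih => exact .lconj _ _ _ _ _ _ (ih hnm)
  case rconj hΛ _ _ ih₁ ih₂ => exact .rconj _ _ _ _ _ _ _ hΛ (ih₁ hnm) (ih₂ hnm)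
  case ldisj hΛ _ _ ih₁ ih₂ => exact .ldisj _ _ _ _ _ _ _ hΛ (ih₁ hnm) (ih₂ hnm)
  case rdisj ih => exact .rdisj _ _ _ _ _ _ (ih hnm)
  case lidisj ih₁ ih₂ => exact .lidisj _ _ _ _ _ _ _ (ih₁ hnm) (ih₂ hnm)
  case ridisjL ih => exact .ridisjL _ _ _ _ _ _ _ (ih hnm)
  case ridisjR ih => exact .ridisjR _ _ _ _ _ _ _ (ih hnm)
  case cut ih₁ ih₂ => exact .cut _ _ _ _ _ _ (ih₁ hnm) (ih₂ hnm)

theorem GT.exists_common {c : Bool} {Γ₁ Δ₁ Γ₂ Δ₂ : Multiset Form} (h₁ : ∃ n, GT c n Γ₁ Δ₁)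
    (h₂ : ∃ n, GT c n Γ₂ Δ₂) : ∃ n, GT c n Γ₁ Δ₁ ∧ GT c n Γ₂ Δ₂ := by
  obtain ⟨n, h₁⟩ := h₁
  obtain ⟨m, h₂⟩ := h₂
  exact ⟨max n m, h₁.mono (le_max_left n m), h₂.mono (le_max_right n m)⟩

/-- Propositional variables and `⊥`. -/
def Form.IsAtomic : Form → Prop
  | var _ => True
  | bot => True
  | _ => False

theorem exists_GT_of_csat_of_atomic {Γ Δ : Multiset Form} (hΓ : ∀ γ ∈ Γ, γ.IsAtomic)
    (hΔ : ∀ δ ∈ Δ, δ.IsAtomic)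
    (h : ∀ v, (∀ γ ∈ Γ, γ.CSat v) → ∃ δ ∈ Δ, δ.CSat v) : ∃ n, GT false n Γ Δ := by
  classical
  by_cases hbot : Form.bot ∈ Γ
  · obtain ⟨Γ, rfl⟩ := Multiset.exists_cons_of_mem hbot
    exact ⟨1, .lbot ..⟩
  obtain ⟨δ, hδ, hsat⟩ := h (fun p => decide (Form.var p ∈ Γ)) fun γ hγ => by
    have := hΓ γ hγ
    cases γ with
    | var p => simpa [Form.CSat] using hγ
    | bot => exact hbot hγ
    | _ => exact this.elim
  have := hΔ δ hδ
  cases δ with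
  | var p =>
    obtain ⟨Γ, rfl⟩ := Multiset.exists_cons_of_mem (of_decide_eq_true hsat)
    obtain ⟨Δ, rfl⟩ := Multiset.exists_cons_of_mem hδ
    exact ⟨1, .ax ..⟩
  | bot => exact hsat.elim
  | _ => exact this.elim

/-- Cut-free derivability of classically valid classical sequents. -/
theorem exists_GT_of_csat (Γ Δ : Multiset Form) (hΓ : ∀ γ ∈ Γ, γ.IsClassical)
    (hΔ : ∀ δ ∈ Δ, δ.IsClassical)
    (h : ∀ v, (∀ γ ∈ Γ, γ.CSat v) → ∃ δ ∈ Δ, δ.CSat v) : ∃ n, GT false n Γ Δ := by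
  induction hN : (Γ.map sizeOf).sum + (Δ.map sizeOf).sum using Nat.strong_induction_on
    generalizing Γ Δ with
  | h N ih =>
  subst hN
  by_cases hΓa : ∀ γ ∈ Γ, γ.IsAtomic
  · by_cases hΔa : ∀ δ ∈ Δ, δ.IsAtomic
    · exact exists_GT_of_csat_of_atomic hΓa hΔa h
    · push Not at hΔa
      obtain ⟨δ, hδ, hδa⟩ := hΔa
      obtain ⟨Δ, rfl⟩ := Multiset.exists_cons_of_mem hδ
      simp only [Multiset.mem_cons, exists_eq_or_imp, forall_eq_or_imp] at hΔ h
      cases δ with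
      | var p => exact (hδa trivial).elim
      | bot => exact (hδa trivial).elim
      | neg α =>
        obtain ⟨n, hn⟩ := ih _ (by simp; omega) (α ::ₘ Γ) Δ
          (Multiset.forall_mem_cons.2 ⟨hΔ.1, hΓ⟩) hΔ.2 (fun v hv => by
            rw [Multiset.forall_mem_cons] at hv
            exact (h v hv.2).resolve_left (not_not_intro hv.1)) rfl
        exact ⟨n + 1, .rneg _ _ _ _ _ hΔ.1 hn⟩
      | conj α β =>
        obtain ⟨n, h₁, h₂⟩ := GT.exists_common
          (ih _ (by simp; omega) Γ (α ::ₘ Δ) hΓ (Multiset.forall_mem_cons.2 ⟨hΔ.1.1, hΔ.2⟩)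
            (fun v hv => by
              simp only [Multiset.mem_cons, exists_eq_or_imp]
              exact (h v hv).imp_left And.left) rfl)
          (ih _ (by simp) Γ (β ::ₘ Δ) hΓ (Multiset.forall_mem_cons.2 ⟨hΔ.1.2, hΔ.2⟩)
            (fun v hv => by
              simp only [Multiset.mem_cons, exists_eq_or_imp]
              exact (h v hv).imp_left And.right) rfl)
        exact ⟨n + 1, by simpa using GT.rconj _ _ _ _ 0 _ _ hΔ.2 h₁ h₂⟩
      | disj α β =>
        obtain ⟨n, hn⟩ := ih _ (by simp; omega) Γ (α ::ₘ β ::ₘ Δ) hΓ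
          (by simp only [Multiset.forall_mem_cons]; exact ⟨hΔ.1.1, hΔ.1.2, hΔ.2⟩)
          (fun v hv => by
            simp only [Multiset.mem_cons, exists_eq_or_imp]
            exact or_assoc.1 (h v hv)) rfl
        exact ⟨n + 1, .rdisj _ _ _ _ _ _ hn⟩
      | idisj α β => exact hΔ.1.elim
  · push Not at hΓa
    obtain ⟨γ, hγ, hγa⟩ := hΓa
    obtain ⟨Γ, rfl⟩ := Multiset.exists_cons_of_mem hγ
    simp only [Multiset.mem_cons, forall_eq_or_imp] at hΓ h
    cases γ with
    | var p => exact (hγa trivial).elim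
    | bot => exact (hγa trivial).elim
    | neg α =>
      obtain ⟨n, hn⟩ := ih _ (by simp; omega) Γ (α ::ₘ Δ) hΓ.2
        (Multiset.forall_mem_cons.2 ⟨hΓ.1, hΔ⟩) (fun v hv => by
          simp only [Multiset.mem_cons, exists_eq_or_imp]
          exact or_iff_not_imp_left.2 fun hα => h v ⟨hα, hv⟩) rfl
      exact ⟨n + 1, .lneg _ _ _ _ _ hΓ.1 hn⟩
    | conj α β =>
      obtain ⟨n, hn⟩ := ih _ (by simp; omega) (α ::ₘ β ::ₘ Γ) Δ
        (by simp only [Multiset.forall_mem_cons]; exact ⟨hΓ.1.1, hΓ.1.2, hΓ.2⟩) hΔ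
        (fun v hv => by
          simp only [Multiset.forall_mem_cons] at hv
          exact h v ⟨⟨hv.1, hv.2.1⟩, hv.2.2⟩) rfl
      exact ⟨n + 1, .lconj _ _ _ _ _ _ hn⟩
    | disj α β =>
      obtain ⟨n, h₁, h₂⟩ := GT.exists_common
        (ih _ (by simp; omega) (α ::ₘ Γ) Δ (Multiset.forall_mem_cons.2 ⟨hΓ.1.1, hΓ.2⟩) hΔ
          (fun v hv => by
            rw [Multiset.forall_mem_cons] at hv
            exact h v ⟨Or.inl hv.1, hv.2⟩) rfl)
        (ih _ (by simp) (β ::ₘ Γ) Δ (Multiset.forall_mem_cons.2 ⟨hΓ.1.2, hΓ.2⟩) hΔ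
          (fun v hv => by
            rw [Multiset.forall_mem_cons] at hv
            exact h v ⟨Or.inr hv.1, hv.2⟩) rfl)
      exact ⟨n + 1, by simpa using GT.ldisj _ _ _ _ 0 _ _ hΔ h₁ h₂⟩
    | idisj α β => exact hΓ.1.elim

theorem satAll_iff_of_classical {Γ : Multiset Form} (hΓ : ∀ γ ∈ Γ, γ.IsClassical) (t : Team) :
    SatAll t Γ ↔ ∀ v ∈ t, ∀ γ ∈ Γ, γ.CSat v :=
  ⟨fun h v hv γ hγ => ((hΓ γ hγ).sat_iff t).1 (h γ hγ) v hv,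
    fun h γ hγ => ((hΓ γ hγ).sat_iff t).2 fun v hv => h v hv γ hγ⟩

/-- A classical antecedent has a largest team, so validity reduces to that team. -/
theorem seqValid_iff_of_classical {Γ Δ : Multiset Form} (hΓ : ∀ γ ∈ Γ, γ.IsClassical) :
    SeqValid Γ Δ ↔ SatVee Δ {v | ∀ γ ∈ Γ, γ.CSat v} :=
  ⟨fun h => h _ ((satAll_iff_of_classical hΓ _).2 fun _ hv => hv),
    fun h t ht => h.mono ((satAll_iff_of_classical hΓ t).1 ht)⟩

theorem exists_GT_of_seqValid_of_classical (Γ Δ : Multiset Form) (hΓ : ∀ γ ∈ Γ, γ.IsClassical)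
    (hΔ : ∀ δ ∈ Δ, δ.WF) (h : SeqValid Γ Δ) : ∃ n, GT false n Γ Δ := by
  induction hN : (Δ.map sizeOf).sum using Nat.strong_induction_on generalizing Δ with
  | h N ih =>
  subst hN
  by_cases hΔc : ∀ δ ∈ Δ, δ.IsClassical
  · exact exists_GT_of_csat Γ Δ hΓ hΔc fun v hv =>
      ((seqValid_iff_of_classical hΓ).1 h).exists_csat hΔc hv
  · push Not at hΔc
    obtain ⟨δ, hδ, hδc⟩ := hΔc
    obtain ⟨χ, φ, ψ, rfl⟩ := (hΔ δ hδ).exists_fill_idisj hδc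
    obtain ⟨Δ, rfl⟩ := Multiset.exists_cons_of_mem hδ
    rw [Multiset.forall_mem_cons, χ.wf_fill_idisj] at hΔ
    rw [seqValid_iff_of_classical hΓ, satVee_fill_idisj, ← seqValid_iff_of_classical hΓ,
      ← seqValid_iff_of_classical hΓ] at h
    have hφ := χ.sizeOf_fill_lt (φ := φ) (ψ := .idisj φ ψ) (by simp; omega)
    have hψ := χ.sizeOf_fill_lt (φ := ψ) (ψ := .idisj φ ψ) (by simp)
    rcases h with h | h
    · obtain ⟨n, hn⟩ := ih _ (by simpa using hφ) (χ.fill φ ::ₘ Δ)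
        (Multiset.forall_mem_cons.2 ⟨hΔ.1.1, hΔ.2⟩) h rfl
      exact ⟨n + 1, .ridisjL _ _ _ _ _ _ _ hn⟩
    · obtain ⟨n, hn⟩ := ih _ (by simpa using hψ) (χ.fill ψ ::ₘ Δ)
        (Multiset.forall_mem_cons.2 ⟨hΔ.1.2, hΔ.2⟩) h rfl
      exact ⟨n + 1, .ridisjR _ _ _ _ _ _ _ hn⟩

theorem exists_GT_of_seqValid (Γ Δ : Multiset Form) (hΓ : ∀ γ ∈ Γ, γ.WF)
    (hΔ : ∀ δ ∈ Δ, δ.WF) (h : SeqValid Γ Δ) : ∃ n, GT false n Γ Δ := by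
  induction hN : (Γ.map sizeOf).sum using Nat.strong_induction_on generalizing Γ with
  | h N ih =>
  subst hN
  by_cases hΓc : ∀ γ ∈ Γ, γ.IsClassical
  · exact exists_GT_of_seqValid_of_classical Γ Δ hΓc hΔ h
  · push Not at hΓc
    obtain ⟨γ, hγ, hγc⟩ := hΓc
    obtain ⟨χ, φ, ψ, rfl⟩ := (hΓ γ hγ).exists_fill_idisj hγc
    obtain ⟨Γ, rfl⟩ := Multiset.exists_cons_of_mem hγ
    rw [Multiset.forall_mem_cons, χ.wf_fill_idisj] at hΓ
    have hφ := χ.sizeOf_fill_lt (φ := φ) (ψ := .idisj φ ψ) (by simp; omega)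
    have hψ := χ.sizeOf_fill_lt (φ := ψ) (ψ := .idisj φ ψ) (by simp)
    obtain ⟨n, h₁, h₂⟩ := GT.exists_common
      (ih _ (by simpa using hφ) (χ.fill φ ::ₘ Γ) (Multiset.forall_mem_cons.2 ⟨hΓ.1.1, hΓ.2⟩)
        (fun t ht => h t (satAll_cons.2 ⟨(χ.sat_fill_idisj φ ψ t).2
          (Or.inl (satAll_cons.1 ht).1), (satAll_cons.1 ht).2⟩)) rfl)
      (ih _ (by simpa using hψ) (χ.fill ψ ::ₘ Γ) (Multiset.forall_mem_cons.2 ⟨hΓ.1.2, hΓ.2⟩)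
        (fun t ht => h t (satAll_cons.2 ⟨(χ.sat_fill_idisj φ ψ t).2
          (Or.inr (satAll_cons.1 ht).1), (satAll_cons.1 ht).2⟩)) rfl)
    exact ⟨n + 1, .lidisj _ _ _ _ _ _ _ h₁ h₂⟩

/-- Equivalence of GT⁻ and GT'⁻: a sequent of PL(∨∨) formulas
is derivable in GT⁻ iff it is derivable in the cut-free variant calculus
GT'⁻ with independent-context rules R∧', L∨' and explicit contraction rules
LC, RC. -/
theorem GT_equiv_GTp (Γ Δ : Multiset Form)
    (hΓ : ∀ φ ∈ Γ, Form.WF φ) (hΔ : ∀ φ ∈ Δ, Form.WF φ) :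
    (∃ n, GT false n Γ Δ) ↔ GTp Γ Δ :=
  ⟨fun ⟨_, h⟩ => h.toGTp, fun h => exists_GT_of_seqValid Γ Δ hΓ hΔ h.sound⟩
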